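/- arXiv:1301.7276 — 2 statements merged into one kernel-verified Lean document; each statement's English description precedes it below -/
import Mathlib

section
/- Let m, n, k be natural numbers, let c, x0, y0 be real numbers with |c| < 1, and let (x,y) ≠ (x0,y0). Write d(x,y) = d_c(x−x0, y−y0) and f(x,y) = x^m·y^n·d(x,y)^{−(k+1/2)}. Then the partial derivative with respect to x of the function (x,y) ↦ (x−x0)·f(x,y), plus the partial derivative with respect to y of the function (x,y) ↦ (y−y0)·f(x,y), evaluated at (x,y), equals (m+n+1−2k)·f(x,y) − m·x0·x^{m−1}·y^n·d(x,y)^{−(k+1/2)} − n·y0·x^m·y^{n−1}·d(x,y)^{−(k+1/2)}, with the convention that the terms with factor m (resp. n) vanish when m = 0 (resp. n = 0). (This is the divergence identity underlying the recursion for C_{mnk} when m+n+1 ≠ 2k.) -/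
/-- For a real parameter `c`, the quadratic form `d_c(x,y) = x^2 + 2cxy + y^2`. -/
def dQuad (c x y : ℝ) : ℝ := x ^ 2 + 2 * c * x * y + y ^ 2

theorem dQuad_pos {c x y : ℝ} (hc : |c| < 1) (hxy : x ≠ 0 ∨ y ≠ 0) : 0 < dQuad c x y := by
  have hc2 : 0 < 1 - c ^ 2 := sub_pos.mpr ((sq_lt_one_iff_abs_lt_one c).mpr hc)
  rcases hxy with h | h
  · have h1 : 0 < (1 - c ^ 2) * x ^ 2 := by positivity
    unfold dQuad
    linarith [sq_nonneg (y + c * x)]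
  · have h1 : 0 < (1 - c ^ 2) * y ^ 2 := by positivity
    unfold dQuad
    linarith [sq_nonneg (x + c * y)]

theorem dQuad_comm (c x y : ℝ) : dQuad c x y = dQuad c y x := by
  unfold dQuad
  ring

theorem hasDerivAt_dQuad_sub (c a v x : ℝ) :
    HasDerivAt (fun t : ℝ => dQuad c (t - a) v) (2 * (x - a) + 2 * c * v) x := by
  have h := (hasDerivAt_id' x).sub_const a
  unfold dQuad
  refine (((h.pow 2).add ((h.const_mul (2 * c)).mul_const v)).add_const (v ^ 2)).congr_deriv ?_
  norm_num

theorem hasDerivAt_sub_mul_pow_mul_dQuad_rpow {c a v x : ℝ} (m : ℕ) (A s : ℝ)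
    (hd : 0 < dQuad c (x - a) v) :
    HasDerivAt (fun t : ℝ => (t - a) * (t ^ m * A * dQuad c (t - a) v ^ s))
      (x ^ m * A * dQuad c (x - a) v ^ s +
        (x - a) * (m * x ^ (m - 1) * A * dQuad c (x - a) v ^ s +
          x ^ m * A * ((2 * (x - a) + 2 * c * v) * s * dQuad c (x - a) v ^ (s - 1)))) x := by
  have h := ((hasDerivAt_id' x).sub_const a).mul (((hasDerivAt_pow m x).mul_const A).mul
    ((hasDerivAt_dQuad_sub c a v x).rpow_const (p := s) (Or.inl hd.ne')))
  refine h.congr_deriv ?_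
  simp only [Pi.mul_apply, one_mul]

theorem natCast_mul_pow_sub_one_mul (m : ℕ) (x : ℝ) : (m : ℝ) * x ^ (m - 1) * x = m * x ^ m := by
  cases m with
  | zero => simp
  | succ m => rw [Nat.add_sub_cancel, pow_succ, mul_assoc]

/-- The divergence identity underlying the recursion for `C_{mnk}` when `m+n+1 ≠ 2k`:
with `d(x,y) = d_c(x−x0, y−y0)` and `f(x,y) = x^m·y^n·d(x,y)^{−(k+1/2)}`, for `(x,y) ≠ (x0,y0)`,
`∂_x((x−x0)f) + ∂_y((y−y0)f) = (m+n+1−2k)·f − m·x0·x^{m−1}·y^n·d^{−(k+1/2)}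
  − n·y0·x^m·y^{n−1}·d^{−(k+1/2)}` (terms with factor `m` resp. `n` vanishing when `m = 0`
resp. `n = 0`). -/
theorem divergence_identity_Cmnk (m n k : ℕ) (c x0 y0 : ℝ) (hc : |c| < 1)
    (x y : ℝ) (hxy : (x, y) ≠ (x0, y0)) :
    deriv (fun x' : ℝ =>
        (x' - x0) * (x' ^ m * y ^ n * (dQuad c (x' - x0) (y - y0)) ^ (-((k : ℝ) + 1 / 2)))) x +
      deriv (fun y' : ℝ =>
        (y' - y0) * (x ^ m * y' ^ n * (dQuad c (x - x0) (y' - y0)) ^ (-((k : ℝ) + 1 / 2)))) y =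
    ((m : ℝ) + n + 1 - 2 * k) *
        (x ^ m * y ^ n * (dQuad c (x - x0) (y - y0)) ^ (-((k : ℝ) + 1 / 2))) -
      (m : ℝ) * x0 * x ^ (m - 1) * y ^ n * (dQuad c (x - x0) (y - y0)) ^ (-((k : ℝ) + 1 / 2)) -
      (n : ℝ) * y0 * x ^ m * y ^ (n - 1) * (dQuad c (x - x0) (y - y0)) ^ (-((k : ℝ) + 1 / 2)) := by
  have hd : 0 < dQuad c (x - x0) (y - y0) := by
    refine dQuad_pos hc ?_
    by_contra! h
    exact hxy (Prod.ext (sub_eq_zero.mp h.1) (sub_eq_zero.mp h.2))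
  have hx := hasDerivAt_sub_mul_pow_mul_dQuad_rpow m (y ^ n) (-((k : ℝ) + 1 / 2)) hd
  have hy := hasDerivAt_sub_mul_pow_mul_dQuad_rpow n (x ^ m) (-((k : ℝ) + 1 / 2))
    (dQuad_comm c (x - x0) (y - y0) ▸ hd)
  have hswap : (fun t : ℝ =>
      (t - y0) * (x ^ m * t ^ n * dQuad c (x - x0) (t - y0) ^ (-((k : ℝ) + 1 / 2)))) =
      fun t : ℝ =>
        (t - y0) * (t ^ n * x ^ m * dQuad c (t - y0) (x - x0) ^ (-((k : ℝ) + 1 / 2))) := by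
    funext t
    rw [mul_comm (x ^ m), dQuad_comm]
  rw [hswap, hx.deriv, hy.deriv, dQuad_comm c (y - y0) (x - x0)]
  have hpow : dQuad c (x - x0) (y - y0) ^ (-((k : ℝ) + 1 / 2)) =
      dQuad c (x - x0) (y - y0) ^ (-((k : ℝ) + 1 / 2) - 1) * dQuad c (x - x0) (y - y0) := by
    rw [← Real.rpow_add_one hd.ne', sub_add_cancel]
  rw [hpow]
  generalize dQuad c (x - x0) (y - y0) ^ (-((k : ℝ) + 1 / 2) - 1) = P
  have hm := natCast_mul_pow_sub_one_mul m x
  have hn := natCast_mul_pow_sub_one_mul n y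
  unfold dQuad
  linear_combination
    (P * ((x - x0) ^ 2 + 2 * c * (x - x0) * (y - y0) + (y - y0) ^ 2)) *
      (y ^ n * hm + x ^ m * hn)
end

section
/- Let m ≥ 1, k ≥ 1 and n ≥ 0 be integers, let c, x0, y0 be real numbers with |c| < 1, let (x,y) ≠ (x0,y0), write d(x,y) = d_c(x−x0, y−y0) and β_k = 1/((1−c^2)(2k−1)). Then x^m·y^n·d(x,y)^{−(k+1/2)} = x0·x^{m−1}·y^n·d(x,y)^{−(k+1/2)} + β_k·( (m−1)·x^{m−2}·y^n·d(x,y)^{1/2−k} − c·n·x^{m−1}·y^{n−1}·d(x,y)^{1/2−k} − ∂_x( x^{m−1}·y^n·d(x,y)^{1/2−k} ) + c·∂_y( x^{m−1}·y^n·d(x,y)^{1/2−k} ) ), where ∂_x and ∂_y denote the partial derivatives at (x,y) and terms with factor (m−1) (resp. n) vanish when m = 1 (resp. n = 0). (This is the identity underlying the first recursion for C_{mnk} when m+n+1 = 2k.) -/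
theorem dQuad_pos_s8 {c u v : ℝ} (hc : |c| < 1) (h : u ≠ 0 ∨ v ≠ 0) : 0 < dQuad c u v := by
  have hc2 : 0 < 1 - c ^ 2 := sub_pos.mpr ((sq_lt_one_iff_abs_lt_one c).mpr hc)
  have hd : dQuad c u v = (u + c * v) ^ 2 + (1 - c ^ 2) * v ^ 2 := by
    unfold dQuad
    ring
  rw [hd]
  by_cases hv : v = 0
  · have hu : u ≠ 0 := h.resolve_right (not_not_intro hv)
    subst hv
    simpa using sq_pos_of_ne_zero hu
  · positivity

theorem dQuad_comm_s8 (c u v : ℝ) : dQuad c u v = dQuad c v u := by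
  unfold dQuad
  ring

theorem hasDerivAt_pow_mul_dQuad_rpow (a : ℕ) (b c p x x0 v : ℝ)
    (h : dQuad c (x - x0) v ≠ 0) :
    HasDerivAt (fun t : ℝ => t ^ a * b * dQuad c (t - x0) v ^ p)
      (a * x ^ (a - 1) * b * dQuad c (x - x0) v ^ p +
        x ^ a * b * ((2 * (x - x0) + 2 * c * v) * p * dQuad c (x - x0) v ^ (p - 1))) x := by
  have hs : HasDerivAt (fun t : ℝ => t - x0) 1 x := (hasDerivAt_id x).sub_const x0
  have hd : HasDerivAt (fun t : ℝ => dQuad c (t - x0) v) (2 * (x - x0) + 2 * c * v) x := by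
    unfold dQuad
    refine (((hs.pow 2).add ((hs.const_mul (2 * c)).mul_const v)).add_const
      (v ^ 2)).congr_deriv ?_
    simp
  exact ((hasDerivAt_pow a x).mul_const b).mul (hd.rpow_const (Or.inl h))

/-- The identity underlying the first recursion (eq. for `C_{mnk}`) when `m+n+1 = 2k`:
with `d(x,y) = d_c(x−x0, y−y0)` and `β_k = 1/((1−c²)(2k−1))`, for `m ≥ 1`, `k ≥ 1`, `n ≥ 0`
and `(x,y) ≠ (x0,y0)`,
`x^m·y^n·d^{−(k+1/2)} = x0·x^{m−1}·y^n·d^{−(k+1/2)} + β_k·((m−1)·x^{m−2}·y^n·d^{1/2−k}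
  − c·n·x^{m−1}·y^{n−1}·d^{1/2−k} − ∂_x(x^{m−1}·y^n·d^{1/2−k}) + c·∂_y(x^{m−1}·y^n·d^{1/2−k}))`
(terms with factor `m−1` resp. `n` vanishing when `m = 1` resp. `n = 0`). -/
theorem recursion_Cmnk_first (m n k : ℕ) (hm : 1 ≤ m) (hk : 1 ≤ k) (c x0 y0 : ℝ)
    (hc : |c| < 1) (x y : ℝ) (hxy : (x, y) ≠ (x0, y0)) :
    x ^ m * y ^ n * (dQuad c (x - x0) (y - y0)) ^ (-((k : ℝ) + 1 / 2)) =
      x0 * x ^ (m - 1) * y ^ n * (dQuad c (x - x0) (y - y0)) ^ (-((k : ℝ) + 1 / 2)) +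
        (1 / ((1 - c ^ 2) * (2 * (k : ℝ) - 1))) *
          (((m : ℝ) - 1) * x ^ (m - 2) * y ^ n *
              (dQuad c (x - x0) (y - y0)) ^ (1 / 2 - (k : ℝ)) -
            c * (n : ℝ) * x ^ (m - 1) * y ^ (n - 1) *
              (dQuad c (x - x0) (y - y0)) ^ (1 / 2 - (k : ℝ)) -
            deriv (fun x' : ℝ =>
              x' ^ (m - 1) * y ^ n * (dQuad c (x' - x0) (y - y0)) ^ (1 / 2 - (k : ℝ))) x +
            c * deriv (fun y' : ℝ =>
              x ^ (m - 1) * y' ^ n * (dQuad c (x - x0) (y' - y0)) ^ (1 / 2 - (k : ℝ))) y) := by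
  have hd : 0 < dQuad c (x - x0) (y - y0) := by
    refine dQuad_pos_s8 hc ?_
    by_contra! h
    exact hxy (Prod.ext (sub_eq_zero.mp h.1) (sub_eq_zero.mp h.2))
  have hdx := (hasDerivAt_pow_mul_dQuad_rpow (m - 1) (y ^ n) c (1 / 2 - (k : ℝ)) x x0 (y - y0)
    hd.ne').deriv
  have hdy := (hasDerivAt_pow_mul_dQuad_rpow n (x ^ (m - 1)) c (1 / 2 - (k : ℝ)) y y0 (x - x0)
    (by rw [dQuad_comm_s8]; exact hd.ne')).deriv
  simp only [dQuad_comm_s8 c _ (x - x0), mul_comm (_ ^ n) (x ^ (m - 1))] at hdy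
  rw [hdx, hdy, show 1 / 2 - (k : ℝ) - 1 = -((k : ℝ) + 1 / 2) by ring]
  have hc2 : 1 - c ^ 2 ≠ 0 := (sub_pos.mpr ((sq_lt_one_iff_abs_lt_one c).mpr hc)).ne'
  have hk2 : 2 * (k : ℝ) - 1 ≠ 0 := by
    have : (1 : ℝ) ≤ k := by exact_mod_cast hk
    linarith
  obtain ⟨a, rfl⟩ := Nat.exists_eq_add_of_le' hm
  simp only [Nat.add_sub_cancel, show a + 1 - 2 = a - 1 by lia]
  push_cast
  generalize dQuad c (x - x0) (y - y0) ^ (-((k : ℝ) + 1 / 2)) = E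
  generalize dQuad c (x - x0) (y - y0) ^ (1 / 2 - (k : ℝ)) = F
  generalize x ^ (a - 1) = X
  generalize y ^ (n - 1) = Y
  field_simp
  ring
end
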